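/- Let l, l1, l2 be lightlike vectors in the closed forward light cone V̄+ such that {l, l1} and {l, l2} are each linearly independent. Then the union of wedges W[l1,l] ∪ W[l2,l] is path connected. -/

import Mathlib

noncomputable section

/-- Minkowski spacetime: ℝ⁴. -/
abbrev M4 : Type := Fin 4 → ℝ

/-- Minkowski bilinear form. -/
def mink (x y : M4) : ℝ := x 0 * y 0 - x 1 * y 1 - x 2 * y 2 - x 3 * y 3

/-- Lightlike vector. -/
def Lightlike (l : M4) : Prop := l ≠ 0 ∧ mink l l = 0

/-- Closed forward light cone. -/
def closedForwardCone : Set M4 := {x | 0 ≤ mink x x ∧ 0 ≤ x 0}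

/-- Open forward light cone. -/
def openForwardCone : Set M4 := {x | 0 < mink x x ∧ 0 < x 0}

/-- The wedge W[l₁,l₂]. -/
def wedge (l1 l2 : M4) : Set M4 :=
  {x | ∃ (α β : ℝ) (p : M4), 0 < α ∧ β < 0 ∧ mink p l1 = 0 ∧ mink p l2 = 0 ∧
      x = α • l1 + β • l2 + p}

/-- Spacelike complement of a set. -/
def scomp (S : Set M4) : Set M4 := {x | ∀ s ∈ S, mink (x - s) (x - s) < 0}

/-- Causal complement: the interior of the spacelike complement. -/
def ccomp (S : Set M4) : Set M4 := interior (scomp S)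

theorem mink_comm (x y : M4) : mink x y = mink y x := by
  simp only [mink]; ring

theorem mink_add_left (x y z : M4) : mink (x + y) z = mink x z + mink y z := by
  simp only [mink, Pi.add_apply]; ring

theorem mink_sub_left (x y z : M4) : mink (x - y) z = mink x z - mink y z := by
  simp only [mink, Pi.sub_apply]; ring

theorem mink_smul_left (a : ℝ) (x y : M4) : mink (a • x) y = a * mink x y := by
  simp only [mink, Pi.smul_apply, smul_eq_mul]; ring

theorem Lightlike.time_pos {l : M4} (hl : Lightlike l) (hc : l ∈ closedForwardCone) :
    0 < l 0 := by
  refine lt_of_le_of_ne hc.2 fun h0 => hl.1 ?_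
  have h := hl.2
  simp only [mink, ← h0] at h
  have e1 : l 1 = 0 := by nlinarith [sq_nonneg (l 1), sq_nonneg (l 2), sq_nonneg (l 3)]
  have e2 : l 2 = 0 := by nlinarith [sq_nonneg (l 1), sq_nonneg (l 2), sq_nonneg (l 3)]
  have e3 : l 3 = 0 := by nlinarith [sq_nonneg (l 1), sq_nonneg (l 2), sq_nonneg (l 3)]
  ext i
  fin_cases i <;> simp [← h0, e1, e2, e3]

theorem Lightlike.mink_pos {l m : M4} (hl : Lightlike l) (hm : Lightlike m)
    (hcl : l ∈ closedForwardCone) (hcm : m ∈ closedForwardCone)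
    (hli : LinearIndependent ℝ ![l, m]) : 0 < mink m l := by
  have l0 := hl.time_pos hcl
  have m0 := hm.time_pos hcm
  by_contra! hle
  have key : (m 0 * l 1 - l 0 * m 1) ^ 2 + (m 0 * l 2 - l 0 * m 2) ^ 2 +
      (m 0 * l 3 - l 0 * m 3) ^ 2 = 2 * (l 0 * m 0) * mink m l := by
    have a := hl.2
    have b := hm.2
    simp only [mink] at a b ⊢
    linear_combination (-(m 0) ^ 2) * a - (l 0) ^ 2 * b
  have hsum : 2 * (l 0 * m 0) * mink m l ≤ 0 :=
    mul_nonpos_of_nonneg_of_nonpos (by positivity) hle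
  have e1 : m 0 * l 1 - l 0 * m 1 = 0 := by
    rw [← sq_eq_zero_iff]
    apply le_antisymm _ (sq_nonneg _)
    linarith [sq_nonneg (m 0 * l 2 - l 0 * m 2),
      sq_nonneg (m 0 * l 3 - l 0 * m 3)]
  have e2 : m 0 * l 2 - l 0 * m 2 = 0 := by
    rw [← sq_eq_zero_iff]
    apply le_antisymm _ (sq_nonneg _)
    linarith [sq_nonneg (m 0 * l 1 - l 0 * m 1),
      sq_nonneg (m 0 * l 3 - l 0 * m 3)]
  have e3 : m 0 * l 3 - l 0 * m 3 = 0 := by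
    rw [← sq_eq_zero_iff]
    apply le_antisymm _ (sq_nonneg _)
    linarith [sq_nonneg (m 0 * l 1 - l 0 * m 1),
      sq_nonneg (m 0 * l 2 - l 0 * m 2)]
  have hz := (LinearIndependent.pair_iff.mp hli (m 0) (-(l 0)) (by
    ext i
    fin_cases i <;> simp <;> linarith)).1
  exact m0.ne' hz

theorem mem_wedge_iff {l m : M4} (hl : Lightlike l) (hm : Lightlike m) (hc : 0 < mink m l)
    (x : M4) : x ∈ wedge m l ↔ 0 < mink x l ∧ mink x m < 0 := by
  constructor
  · rintro ⟨α, β, p, hα, hβ, hpm, hpl, rfl⟩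
    simp only [mink_add_left, mink_smul_left, hpm, hpl, hl.2, hm.2, mink_comm l m]
    constructor
    · nlinarith [mul_pos hα hc]
    · nlinarith [mul_neg_of_neg_of_pos hβ hc]
  · rintro ⟨h1, h2⟩
    refine ⟨mink x l / mink m l, mink x m / mink m l,
      x - ((mink x l / mink m l) • m + (mink x m / mink m l) • l),
      div_pos h1 hc, div_neg_of_neg_of_pos h2 hc, ?_, ?_, by abel⟩
    · simp only [mink_sub_left, mink_add_left, mink_smul_left, hm.2, mink_comm l m]
      field_simp
      ring
    · simp only [mink_sub_left, mink_add_left, mink_smul_left, hl.2]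
      field_simp
      ring

theorem convex_wedge {l m : M4} (hl : Lightlike l) (hm : Lightlike m) (hc : 0 < mink m l) :
    Convex ℝ (wedge m l) := by
  intro x hx y hy a b ha hb hab
  rw [mem_wedge_iff hl hm hc] at *
  simp only [mink_add_left, mink_smul_left]
  obtain ⟨x1, x2⟩ := hx
  obtain ⟨y1, y2⟩ := hy
  have hor : 0 < a ∨ 0 < b := by
    by_contra! h
    linarith
  constructor <;> rcases hor with h | h <;>
    nlinarith [mul_pos h x1, mul_pos h y1, mul_neg_of_pos_of_neg h x2,
      mul_neg_of_pos_of_neg h y2, mul_nonneg ha x1.le, mul_nonneg hb y1.le,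
      mul_nonpos_of_nonneg_of_nonpos ha x2.le, mul_nonpos_of_nonneg_of_nonpos hb y2.le]

theorem wedge_union_isPathConnected (l l1 l2 : M4)
    (hl : Lightlike l) (h1 : Lightlike l1) (h2 : Lightlike l2)
    (hcl : l ∈ closedForwardCone) (hc1 : l1 ∈ closedForwardCone)
    (hc2 : l2 ∈ closedForwardCone)
    (hli1 : LinearIndependent ℝ ![l, l1]) (hli2 : LinearIndependent ℝ ![l, l2]) :
    IsPathConnected (wedge l1 l ∪ wedge l2 l) := by
  have c1 := hl.mink_pos h1 hcl hc1 hli1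
  have c2 := hl.mink_pos h2 hcl hc2 hli2
  obtain ⟨N, hN1, hN2⟩ : ∃ N : ℝ, mink l1 l2 < N * mink l1 l ∧ mink l1 l2 < N * mink l2 l := by
    obtain ⟨N, hN⟩ := exists_gt (max (mink l1 l2 / mink l1 l) (mink l1 l2 / mink l2 l))
    rw [max_lt_iff, div_lt_iff₀ c1, div_lt_iff₀ c2] at hN
    exact ⟨N, hN⟩
  have w1 : l1 + l2 - N • l ∈ wedge l1 l := by
    rw [mem_wedge_iff hl h1 c1]
    simp only [mink_sub_left, mink_add_left, mink_smul_left, hl.2, h1.2, mink_comm l l1,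
      mink_comm l2 l1]
    constructor <;> linarith
  have w2 : l1 + l2 - N • l ∈ wedge l2 l := by
    rw [mem_wedge_iff hl h2 c2]
    simp only [mink_sub_left, mink_add_left, mink_smul_left, hl.2, h2.2, mink_comm l l2]
    constructor <;> linarith
  exact ((convex_wedge hl h1 c1).isPathConnected ⟨_, w1⟩).union
    ((convex_wedge hl h2 c2).isPathConnected ⟨_, w2⟩) ⟨_, w1, w2⟩
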